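/- Let p ≥ 2 be a real number and let δ > 0. Then for all real numbers a, b ≥ 0 with |a − b| ≥ δ, one has ((a+b)/2)^p ≤ (a^p + b^p)/2 − (δ/2)^p. -/

import Mathlib

theorem Real.sq_rpow_half {x : ℝ} (hx : 0 ≤ x) (p : ℝ) : (x ^ 2) ^ (p / 2) = x ^ p := by
  rw [← Real.rpow_natCast, ← Real.rpow_mul hx]
  congr 1
  push_cast
  ring

/-- Pointwise uniform convexity of `t ↦ t ^ p` on `[0, ∞)` for `p ≥ 2`
(a pointwise form of Clarkson's first inequality). -/
theorem uniform_convexity_rpow (p δ a b : ℝ) (hp : 2 ≤ p) (hδ : 0 < δ)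
    (ha : 0 ≤ a) (hb : 0 ≤ b) (hab : δ ≤ |a - b|) :
    ((a + b) / 2) ^ p ≤ (a ^ p + b ^ p) / 2 - (δ / 2) ^ p := by
  have hq : 1 ≤ p / 2 := by linarith
  have hδ' : (δ / 2) ^ p ≤ (|a - b| / 2) ^ p := by gcongr
  have hadd : ((a + b) / 2) ^ p + (|a - b| / 2) ^ p ≤ ((a ^ 2 + b ^ 2) / 2) ^ (p / 2) := by
    rw [← Real.sq_rpow_half (by positivity : 0 ≤ (a + b) / 2),
      ← Real.sq_rpow_half (by positivity : 0 ≤ |a - b| / 2)]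
    refine (Real.add_rpow_le_rpow_add (sq_nonneg _) (sq_nonneg _) hq).trans_eq ?_
    rw [div_pow |a - b|, sq_abs]
    congr 1
    ring
  have hconv : ((a ^ 2 + b ^ 2) / 2) ^ (p / 2) ≤ (a ^ p + b ^ p) / 2 := by
    have h := (convexOn_rpow hq).2 (Set.mem_Ici.2 (sq_nonneg a)) (Set.mem_Ici.2 (sq_nonneg b))
      (by norm_num : (0 : ℝ) ≤ 1 / 2) (by norm_num : (0 : ℝ) ≤ 1 / 2) (by norm_num)
    simp only [smul_eq_mul, Real.sq_rpow_half ha, Real.sq_rpow_half hb, ← mul_add] at h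
    rw [div_eq_inv_mul, div_eq_inv_mul _ (2 : ℝ), ← one_div]
    simpa only [div_eq_inv_mul, mul_one] using h
  linarith
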